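/- arXiv:1311.0603 — 4 statements merged into one kernel-verified Lean document; each statement's English description precedes it below -/
import Mathlib

section
/- Every connected K_{1,d}-free graph G on at least 2 vertices (for an integer d ≥ 3) admits a star partition S_1, S_2, …, S_r of its vertex set such that |S_i| ≤ d−1 for every i ∈ {1, …, r−1} and |S_r| ≤ d. -/
namespace SimpleGraph

/-- The induced subgraph on `S` contains a spanning star. -/
def HasSpanningStar {V : Type*} (G : SimpleGraph V) (S : Finset V) : Prop :=
  ∃ c ∈ S, ∀ w ∈ S, w ≠ c → G.Adj c w

/-- No vertex of `G` has `d` pairwise non-adjacent neighbours. -/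
def InducedStarFree {V : Type*} (G : SimpleGraph V) (d : ℕ) : Prop :=
  ∀ (v : V) (A : Finset V), (∀ a ∈ A, G.Adj v a) →
    (∀ a ∈ A, ∀ b ∈ A, a ≠ b → ¬ G.Adj a b) → A.card < d

theorem InducedStarFree.induce {V : Type*} {G : SimpleGraph V} {d : ℕ}
    (h : G.InducedStarFree d) (s : Set V) : (G.induce s).InducedStarFree d := by
  intro v A hadj hind
  rw [← Finset.card_map (Function.Embedding.subtype s)]
  apply h v
  · simp only [Finset.mem_map]
    rintro _ ⟨a, ha, rfl⟩
    exact hadj a ha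
  · simp only [Finset.mem_map]
    rintro _ ⟨a, ha, rfl⟩ _ ⟨b, hb, rfl⟩ hab
    exact hind a ha b hb fun e => hab (e ▸ rfl)

theorem HasSpanningStar.map_subtype {V : Type*} {G : SimpleGraph V} {s : Set V} {S : Finset s}
    (h : (G.induce s).HasSpanningStar S) :
    G.HasSpanningStar (S.map (Function.Embedding.subtype s)) := by
  obtain ⟨c, hc, hadj⟩ := h
  refine ⟨c, Finset.mem_map_of_mem _ hc, ?_⟩
  simp only [Finset.mem_map]
  rintro _ ⟨w, hw, rfl⟩ hne
  exact hadj w hw fun e => hne (e ▸ rfl)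

theorem Connected.exists_adj_dist_add_one_eq {V : Type*} {G : SimpleGraph V} (hconn : G.Connected)
    {w r : V} (hne : w ≠ r) : ∃ u, G.Adj w u ∧ G.dist u r + 1 = G.dist w r := by
  obtain ⟨p, hp⟩ := hconn.exists_walk_length_eq_dist w r
  cases p with
  | nil => exact absurd rfl hne
  | @cons _ u _ hadj q =>
    refine ⟨u, hadj, ?_⟩
    have hq := dist_le q
    have htri := hconn.dist_triangle (u := w) (v := u) (w := r)
    rw [dist_eq_one_iff_adj.2 hadj] at htri
    simp only [Walk.length_cons] at hp
    omega

/-- If a set contains `r` and every other vertex of it has a neighbour in it at which `f`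
is smaller, then it induces a connected subgraph. -/
theorem connected_induce_of_forall_exists_adj_lt {V : Type*} {G : SimpleGraph V} {s : Set V}
    {r : V} (hr : r ∈ s) (f : V → ℕ)
    (h : ∀ w ∈ s, w ≠ r → ∃ u ∈ s, G.Adj w u ∧ f u < f w) : (G.induce s).Connected := by
  have key : ∀ n, ∀ w (hw : w ∈ s), f w = n → (G.induce s).Reachable ⟨r, hr⟩ ⟨w, hw⟩ := by
    intro n
    induction n using Nat.strong_induction_on with
    | _ n ih =>
      intro w hw hn
      by_cases hwr : w = r
      · subst hwr
        rfl
      · obtain ⟨u, hu, hadj, hlt⟩ := h w hw hwr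
        have huw : (G.induce s).Adj ⟨u, hu⟩ ⟨w, hw⟩ := hadj.symm
        exact (ih _ (hn ▸ hlt) u hu rfl).trans huw.reachable
  exact (connected_iff_exists_forall_reachable _).2 ⟨⟨r, hr⟩, fun w => key _ w w.2 rfl⟩

/-- A connected graph without induced `K_{1,d}` either is spanned by a star on at most `d`
vertices, or has a star on at most `d - 1` vertices whose removal leaves a connected graph with
at least two vertices. -/
theorem InducedStarFree.exists_removable_star {V : Type*} [Fintype V] [DecidableEq V]
    {G : SimpleGraph V} {d : ℕ} (hfree : G.InducedStarFree d) (hd : 3 ≤ d)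
    (hconn : G.Connected) (hcard : 2 ≤ Fintype.card V) :
    (G.HasSpanningStar Finset.univ ∧ Fintype.card V ≤ d) ∨
    ∃ S : Finset V, G.HasSpanningStar S ∧ 2 ≤ S.card ∧ S.card ≤ d - 1 ∧
      2 ≤ Sᶜ.card ∧ (G.induce {v | v ∉ S}).Connected := by
  classical
  obtain ⟨r⟩ := hconn.nonempty
  obtain ⟨f, hzero, hparent, hstep⟩ : ∃ f : V → ℕ, f r = 0 ∧
      (∀ w, w ≠ r → ∃ u, G.Adj w u ∧ f u + 1 = f w) ∧ ∀ u w, G.Adj u w → f u ≤ f w + 1 := by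
    refine ⟨fun w => G.dist w r, dist_self, fun w hw => hconn.exists_adj_dist_add_one_eq hw,
      fun u w huw => ?_⟩
    have htri := hconn.dist_triangle (u := u) (v := w) (w := r)
    rw [dist_eq_one_iff_adj.2 huw] at htri
    exact htri.trans (Nat.add_comm _ _).le
  obtain ⟨v, -, hmax⟩ := Finset.exists_max_image Finset.univ f ⟨r, Finset.mem_univ r⟩
  replace hmax : ∀ w, f w ≤ f v := fun w => hmax w (Finset.mem_univ w)
  have hvr : v ≠ r := by
    rintro rfl
    obtain ⟨w, hw⟩ := Fintype.exists_ne_of_one_lt_card hcard v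
    obtain ⟨u, -, hu⟩ := hparent w hw
    have := hmax w
    omega
  obtain ⟨p, hvp, hp⟩ := hparent v hvr
  -- the deepest vertices that are joined to the previous level only through `p`
  let P : Finset V := {w | G.Adj p w ∧ f w = f v ∧ ∀ u, G.Adj w u → f u + 1 = f w → u = p}
  have hP : ∀ w, w ∈ P ↔ G.Adj p w ∧ f w = f v ∧ ∀ u, G.Adj w u → f u + 1 = f w → u = p := by
    simp [P]
  have hcompl : ∀ S : Finset V, r ∉ S → Sᶜ.card < 2 → ∀ w, w ∉ S → w = r := by
    intro S hrS hS w hw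
    exact Finset.card_le_one.1 (Nat.le_of_lt_succ hS) w (by simpa using hw) r (by simpa using hrS)
  by_cases hedge : ∃ a ∈ P, ∃ b ∈ P, a ≠ b ∧ G.Adj a b
  · obtain ⟨a, ha, b, hb, hab, hadj⟩ := hedge
    obtain ⟨hpa, hfa, -⟩ := (hP a).1 ha
    obtain ⟨hpb, hfb, -⟩ := (hP b).1 hb
    have hnot : ∀ u, f u < f v → u ∉ ({a, b} : Finset V) := by
      intro u hu
      simp only [Finset.mem_insert, Finset.mem_singleton, not_or]
      constructor <;> rintro rfl <;> omega
    have hrS := hnot r (by omega)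
    have hS : ({a, b} : Finset V).card = 2 := Finset.card_pair hab
    by_cases hbig : 2 ≤ ({a, b} : Finset V)ᶜ.card
    · refine Or.inr ⟨{a, b}, ⟨a, by simp, ?_⟩, hS.ge, by omega, hbig, ?_⟩
      · grind
      · refine connected_induce_of_forall_exists_adj_lt (r := r) hrS f fun w _ hw => ?_
        obtain ⟨u, hwu, hu⟩ := hparent w hw
        have := hmax w
        exact ⟨u, hnot u (by omega), hwu, by omega⟩
    · have hall := hcompl _ hrS (not_le.1 hbig)
      have hpr := hall p (hnot p (by omega))
      refine Or.inl ⟨⟨p, Finset.mem_univ p, fun w _ hw => ?_⟩, ?_⟩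
      · grind
      · have := Finset.card_add_card_compl ({a, b} : Finset V)
        omega
  · have hind : ∀ a ∈ P, ∀ b ∈ P, a ≠ b → ¬ G.Adj a b := fun a ha b hb hab hadj =>
      hedge ⟨a, ha, b, hb, hab, hadj⟩
    by_cases hpr : p = r
    · subst hpr
      have hroot : ∀ u, f u = 0 → u = p := fun u hu => by
        by_contra hne
        obtain ⟨x, -, hx⟩ := hparent u hne
        omega
      have hmem : ∀ w, w ≠ p → w ∈ P := fun w hw => by
        obtain ⟨u, hwu, hu⟩ := hparent w hw
        have := hmax w
        obtain rfl := hroot u (by omega)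
        exact (hP w).2 ⟨hwu.symm, by omega, fun x _ hx => hroot x (by omega)⟩
      refine Or.inl ⟨⟨p, Finset.mem_univ p, fun w _ hw => ((hP w).1 (hmem w hw)).1⟩, ?_⟩
      have hlt := hfree p P (fun a ha => ((hP a).1 ha).1) hind
      have hle : (Finset.univ : Finset V).card ≤ (insert p P).card :=
        Finset.card_le_card fun w _ => by
          by_cases hw : w = p
          · simp [hw]
          · exact Finset.mem_insert_of_mem (hmem w hw)
      have := Finset.card_insert_le p P
      rw [Finset.card_univ] at hle
      omega
    · obtain ⟨q, hpq, hq⟩ := hparent p hpr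
      have hPcard : P.card + 2 ≤ d := by
        have hqP : q ∉ P := fun h => by
          have := ((hP q).1 h).2.1
          omega
        have hqadj : ∀ a ∈ P, ¬ G.Adj a q := fun a ha hadj => by
          have := hstep a q hadj
          have := ((hP a).1 ha).2.1
          omega
        have hlt := hfree p (insert q P)
          (by
            intro a ha
            rcases Finset.mem_insert.1 ha with rfl | ha
            · exact hpq
            · exact ((hP a).1 ha).1)
          (by
            intro a ha b hb hab hadj
            rcases Finset.mem_insert.1 ha with rfl | haP <;>
              rcases Finset.mem_insert.1 hb with rfl | hbP
            · exact hab rfl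
            · exact hqadj b hbP hadj.symm
            · exact hqadj a haP hadj
            · exact hind a haP b hbP hab hadj)
        rw [Finset.card_insert_of_notMem hqP] at hlt
        omega
      obtain ⟨Q, hPQ, hQpos, hQcard, hQ⟩ : ∃ Q : Finset V, P ⊆ Q ∧ 0 < Q.card ∧ Q.card + 2 ≤ d ∧
          ∀ w ∈ Q, G.Adj p w ∧ f w = f v := by
        rcases P.eq_empty_or_nonempty with hempty | hne
        · exact ⟨{v}, by simp [hempty], by simp, by simpa using hd, by simp [hvp.symm]⟩
        · exact ⟨P, subset_rfl, hne.card_pos, hPcard, fun w hw =>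
            ⟨((hP w).1 hw).1, ((hP w).1 hw).2.1⟩⟩
      have hnotQ : ∀ u, f u < f v → u ∉ Q := fun u hu h => by
        have := (hQ u h).2
        omega
      have hScard : (insert p Q).card = Q.card + 1 :=
        Finset.card_insert_of_notMem (hnotQ p (by omega))
      have hnot : ∀ u, f u < f v → u ≠ p → u ∉ insert p Q := fun u hu hup h =>
        (Finset.mem_insert.1 h).elim hup (hnotQ u hu)
      have hrS := hnot r (by omega) (Ne.symm hpr)
      by_cases hbig : 2 ≤ (insert p Q)ᶜ.card
      · refine Or.inr ⟨insert p Q, ⟨p, Finset.mem_insert_self p Q, fun w hw hwp =>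
          (hQ w (Finset.mem_of_mem_insert_of_ne hw hwp)).1⟩, by omega, by omega, hbig, ?_⟩
        refine connected_induce_of_forall_exists_adj_lt (r := r) hrS f fun w hwS hw => ?_
        obtain ⟨u, hwu, hu⟩ := hparent w hw
        have hwmax := hmax w
        by_cases hup : u = p
        · subst hup
          have hwP : w ∉ P := fun h => hwS (Finset.mem_insert_of_mem (hPQ h))
          have hfw : f w = f v := by omega
          simp only [hP, hwu.symm, hfw, true_and, not_forall] at hwP
          obtain ⟨x, hwx, hx, hxu⟩ := hwP
          exact ⟨x, hnot x (by omega) hxu, hwx, by omega⟩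
        · exact ⟨u, hnot u (by omega) hup, hwu, by omega⟩
      · have hall := hcompl _ hrS (not_le.1 hbig)
        have hqr := hall q (hnot q (by omega) hpq.ne')
        refine Or.inl ⟨⟨p, Finset.mem_univ p, fun w _ hwp => ?_⟩, ?_⟩
        · by_cases hw : w ∈ insert p Q
          · exact (hQ w (Finset.mem_of_mem_insert_of_ne hw hwp)).1
          · rw [hall w hw, ← hqr]
            exact hpq
        · have := Finset.card_add_card_compl (insert p Q)
          omega

/-- A connected graph with at least two vertices and without induced `K_{1,d}` can be partitioned
into stars on at most `d - 1` vertices and a last star on at most `d` vertices. -/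
theorem InducedStarFree.exists_star_partition {V : Type*} [Fintype V]
    {G : SimpleGraph V} {d : ℕ} (hfree : G.InducedStarFree d) (hd : 3 ≤ d)
    (hconn : G.Connected) (hcard : 2 ≤ Fintype.card V) :
    ∃ (m : ℕ) (S : Fin (m + 1) → Finset V),
      (∀ v, ∃! i, v ∈ S i) ∧ (∀ i, 2 ≤ (S i).card) ∧ (∀ i, G.HasSpanningStar (S i)) ∧
      (∀ i, i ≠ Fin.last m → (S i).card ≤ d - 1) ∧ (S (Fin.last m)).card ≤ d := by
  classical
  induction hn : Fintype.card V using Nat.strong_induction_on generalizing V with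
  | _ n ih =>
    rcases hfree.exists_removable_star hd hconn hcard with
      ⟨hstar, hle⟩ | ⟨T, hstar, hT, hTd, hTc, hTconn⟩
    · refine ⟨0, fun _ => Finset.univ, fun v => ⟨0, Finset.mem_univ v, fun i _ => Fin.eq_zero i⟩,
        fun _ => hcard, fun _ => hstar, fun i hi => absurd (Fin.eq_zero i) hi, hle⟩
    · have hsub : Fintype.card {v | v ∉ T} = Tᶜ.card := by
        rw [Fintype.card_subtype]
        congr 1
        ext
        simp
      have hsum := Finset.card_add_card_compl T
      obtain ⟨m, S, hpart, htwo, hS, hsmall, hlast⟩ :=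
        ih _ (by omega) (hfree.induce {v | v ∉ T}) hTconn (by omega) rfl
      let e := Function.Embedding.subtype (· ∈ {v | v ∉ T})
      have hmem : ∀ i v, v ∈ (S i).map e ↔ ∃ h : v ∉ T, (⟨v, h⟩ : {v | v ∉ T}) ∈ S i := by
        intro i v
        simp [e]
      refine ⟨m + 1, Fin.cons T fun i => (S i).map e, fun v => ?_, fun i => ?_, fun i => ?_,
        fun i hi => ?_, ?_⟩
      · by_cases hv : v ∈ T
        · refine ⟨0, hv, fun i hi => ?_⟩
          cases i using Fin.cases with
          | zero => rfl
          | succ i => exact absurd hv ((hmem i v).1 hi).1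
        · obtain ⟨i, hi, huniq⟩ := hpart ⟨v, hv⟩
          refine ⟨i.succ, (hmem i v).2 ⟨hv, hi⟩, fun j hj => ?_⟩
          cases j using Fin.cases with
          | zero => exact absurd hj hv
          | succ j => rw [huniq j ((hmem j v).1 hj).2]
      · cases i using Fin.cases with
        | zero => exact hT
        | succ i => simpa using htwo i
      · cases i using Fin.cases with
        | zero => exact hstar
        | succ i => exact (hS i).map_subtype
      · cases i using Fin.cases with
        | zero => exact hTd
        | succ i => simpa using hsmall i fun h => hi (h ▸ Fin.succ_last m)
      · rw [← Fin.succ_last]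
        simpa using hlast

end SimpleGraph

/-- Every connected `K_{1,d}`-free graph `G` on at least 2 vertices
(for an integer `d ≥ 3`) admits a star partition `S_1, …, S_r` of its vertex set
such that `|S_i| ≤ d − 1` for every `i ∈ {1, …, r−1}` and `|S_r| ≤ d`.
A star partition is a partition into sets of size at least 2, each of which has a
"center" adjacent (in `G`) to all other vertices of the set.  `K_{1,d}`-freeness
is expressed as: no vertex has `d` pairwise non-adjacent neighbours. -/
theorem stmt_0 {V : Type*} [Fintype V] [DecidableEq V]
    (G : SimpleGraph V) (d : ℕ) (hd : 3 ≤ d)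
    (hconn : G.Connected) (hcard : 2 ≤ Fintype.card V)
    (hfree : ∀ (v : V) (A : Finset V), (∀ a ∈ A, G.Adj v a) →
      (∀ a ∈ A, ∀ b ∈ A, a ≠ b → ¬ G.Adj a b) → A.card < d) :
    ∃ (r : ℕ) (hr : 0 < r) (S : Fin r → Finset V),
      (∀ v : V, ∃! i, v ∈ S i) ∧
      (∀ i, 2 ≤ (S i).card) ∧
      (∀ i, ∃ c ∈ S i, ∀ w ∈ S i, w ≠ c → G.Adj c w) ∧
      (∀ i : Fin r, (i : ℕ) < r - 1 → (S i).card ≤ d - 1) ∧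
      (S ⟨r - 1, by omega⟩).card ≤ d := by
  obtain ⟨m, S, hpart, htwo, hstar, hsmall, hlast⟩ :=
    SimpleGraph.InducedStarFree.exists_star_partition hfree hd hconn hcard
  refine ⟨m + 1, m.succ_pos, S, hpart, htwo, hstar, fun i hi => hsmall i ?_, hlast⟩
  rintro rfl
  simp at hi
end

section
/- Let G be a connected finite simple graph on at least 2 vertices and let T be a spanning tree of G with maximum degree Δ(T). Then G admits a star partition S_1, S_2, …, S_r of its vertex set such that |S_i| ≤ Δ(T) for every i ∈ {1, …, r−1} and |S_r| ≤ Δ(T) + 1. In particular, every connected graph on at least 2 vertices has a star partition. -/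
/-- In a connected graph every vertex other than `ρ` has a neighbour one step closer to `ρ`. -/
theorem SimpleGraph.Connected.exists_adj_dist_add_one_eq_s1 {V : Type*} {T : SimpleGraph V}
    (hT : T.Connected) {ρ v : V} (hv : v ≠ ρ) :
    ∃ w, T.Adj v w ∧ T.dist w ρ + 1 = T.dist v ρ := by
  obtain ⟨p, hp⟩ := hT.exists_walk_length_eq_dist v ρ
  cases p with
  | nil => exact absurd rfl hv
  | @cons _ w _ h q =>
    refine ⟨w, h, ?_⟩
    have h₁ := SimpleGraph.dist_le q
    have h₂ : T.dist v ρ ≤ T.dist v w + T.dist w ρ := hT.dist_triangle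
    rw [SimpleGraph.dist_eq_one_iff_adj.mpr h] at h₂
    rw [SimpleGraph.Walk.length_cons] at hp
    omega

/-- A set of vertices closed under taking parents, in a graph whose degrees are at most `D` and
which is rooted at `ρ` by a parent map `par` with depth function `d`, splits into stars of at most
`D` vertices, except that the last one may have `D + 1`. -/
theorem SimpleGraph.exists_star_partition_of_parent {V : Type*} [Fintype V] [DecidableEq V]
    (T : SimpleGraph V) [DecidableRel T.Adj] {D : ℕ} (hD : ∀ v, T.degree v ≤ D)
    (ρ : V) (par : V → V) (d : V → ℕ) (hρ : d ρ = 0)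
    (hadj : ∀ v, v ≠ ρ → T.Adj v (par v)) (hd : ∀ v, v ≠ ρ → d (par v) + 1 = d v)
    (W : Finset V) (hρW : ρ ∈ W) (hW : ∀ v ∈ W, v ≠ ρ → par v ∈ W) (hcard : 2 ≤ W.card) :
    ∃ (r : ℕ) (S : Fin (r + 1) → Finset V),
      (∀ i, S i ⊆ W) ∧
      (∀ v ∈ W, ∃! i, v ∈ S i) ∧
      (∀ i, 2 ≤ (S i).card) ∧
      (∀ i, ∃ c ∈ S i, ∀ w ∈ S i, w ≠ c → T.Adj c w) ∧
      (∀ i, i ≠ Fin.last r → (S i).card ≤ D) ∧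
      (S (Fin.last r)).card ≤ D + 1 := by
  induction W using Finset.strongInduction with
  | H W ih =>
  have single (c : V) (hc : c ∈ W) (hcW : ∀ w ∈ W, w ≠ c → T.Adj c w) (hle : W.card ≤ D + 1) :
      ∃ (r : ℕ) (S : Fin (r + 1) → Finset V),
        (∀ i, S i ⊆ W) ∧
        (∀ v ∈ W, ∃! i, v ∈ S i) ∧
        (∀ i, 2 ≤ (S i).card) ∧
        (∀ i, ∃ c ∈ S i, ∀ w ∈ S i, w ≠ c → T.Adj c w) ∧
        (∀ i, i ≠ Fin.last r → (S i).card ≤ D) ∧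
        (S (Fin.last r)).card ≤ D + 1 :=
    ⟨0, fun _ => W, fun _ => subset_rfl, fun v hv => ⟨0, hv, fun i _ => Fin.fin_one_eq_zero i⟩,
      fun _ => hcard, fun _ => ⟨c, hc, hcW⟩,
      fun i hi => absurd (Fin.fin_one_eq_zero i) hi, hle⟩
  obtain ⟨v, hvW, hmax⟩ := W.exists_max_image d ⟨ρ, hρW⟩
  have hvρ : v ≠ ρ := by
    rintro rfl
    obtain ⟨u, hu, huv⟩ := Finset.exists_mem_ne (by omega : 1 < W.card) v
    have := hmax u hu
    have := hd u huv
    omega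
  have hdv := hd v hvρ
  have hpW := hW v hvW hvρ
  set p := par v
  set C := W.filter (fun u => u ≠ ρ ∧ par u = p)
  have memC {u : V} : u ∈ C ↔ u ∈ W ∧ u ≠ ρ ∧ par u = p := Finset.mem_filter
  have hCadj {u : V} (hu : u ∈ C) : T.Adj p u := by
    obtain ⟨-, huρ, hup⟩ := memC.1 hu
    exact hup ▸ (hadj u huρ).symm
  have hCd {u : V} (hu : u ∈ C) : d u = d p + 1 := by
    obtain ⟨-, huρ, hup⟩ := memC.1 hu
    rw [← hup, hd u huρ]
  have hvC : v ∈ C := memC.2 ⟨hvW, hvρ, rfl⟩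
  have hpC : p ∉ C := fun h => (hCadj h).ne rfl
  by_cases hpρ : p = ρ
  · have hsub : W.erase ρ ⊆ T.neighborFinset ρ := by
      intro w hw
      obtain ⟨hwρ, hwW⟩ := Finset.mem_erase.1 hw
      have hpw : par w = ρ := by
        by_contra hne
        have := hd _ hne
        have := hd w hwρ
        have := hmax w hwW
        rw [hpρ, hρ] at hdv
        omega
      rw [SimpleGraph.mem_neighborFinset]
      exact hpw ▸ (hadj w hwρ).symm
    refine single ρ hρW (fun w hw hwρ => ?_) ?_
    · exact (T.mem_neighborFinset ρ w).1 (hsub (Finset.mem_erase.2 ⟨hwρ, hw⟩))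
    · have h₁ := Finset.card_le_card hsub
      rw [SimpleGraph.card_neighborFinset_eq_degree, Finset.card_erase_of_mem hρW] at h₁
      have := hD ρ
      omega
  have hdp := hd p hpρ
  have hC_lt : C.card + 1 ≤ D := by
    have hsub : C ⊆ (T.neighborFinset p).erase (par p) := by
      intro u hu
      refine Finset.mem_erase.2 ⟨?_, (T.mem_neighborFinset p u).2 (hCadj hu)⟩
      rintro rfl
      have := hCd hu
      omega
    have hmem : par p ∈ T.neighborFinset p := (T.mem_neighborFinset p _).2 (hadj p hpρ)
    have h₁ := Finset.card_le_card hsub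
    have h₂ := Finset.card_pos.2 ⟨_, hmem⟩
    rw [Finset.card_erase_of_mem hmem] at h₁
    rw [SimpleGraph.card_neighborFinset_eq_degree] at h₁ h₂
    have := hD p
    omega
  set B := insert p C
  have hBcard : B.card = C.card + 1 := Finset.card_insert_of_notMem hpC
  have hBW : B ⊆ W := Finset.insert_subset hpW (Finset.filter_subset _ _)
  have hBstar : ∀ w ∈ B, w ≠ p → T.Adj p w := fun w hw hwp =>
    hCadj ((Finset.mem_insert.1 hw).resolve_left hwp)
  have hρB : ρ ∉ B := by
    intro h
    rcases Finset.mem_insert.1 h with h | h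
    · exact hpρ h.symm
    · exact (memC.1 h).2.1 rfl
  have hρW' : ρ ∈ W \ B := Finset.mem_sdiff.2 ⟨hρW, hρB⟩
  by_cases hW'card : 2 ≤ (W \ B).card
  · have hW' : ∀ u ∈ W \ B, u ≠ ρ → par u ∈ W \ B := by
      intro u hu huρ
      obtain ⟨huW, huB⟩ := Finset.mem_sdiff.1 hu
      refine Finset.mem_sdiff.2 ⟨hW u huW huρ, fun h => ?_⟩
      rcases Finset.mem_insert.1 h with h | h
      · exact huB (Finset.mem_insert_of_mem (memC.2 ⟨huW, huρ, h⟩))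
      · have := hCd h
        have := hd u huρ
        have := hmax u huW
        omega
    have hss : W \ B ⊂ W := Finset.sdiff_ssubset hBW ⟨p, Finset.mem_insert_self _ _⟩
    obtain ⟨r, S, hSW, hSu, hS2, hSs, hSD, hSl⟩ := ih (W \ B) hss hρW' hW' hW'card
    have hSB {u : V} {i : Fin (r + 1)} (hu : u ∈ S i) : u ∉ B :=
      (Finset.mem_sdiff.1 (hSW i hu)).2
    refine ⟨r + 1, Fin.cons B S, Fin.forall_fin_succ.2 ⟨hBW, fun i => ?_⟩, fun u hu => ?_,
      Fin.forall_fin_succ.2 ⟨?_, fun i => ?_⟩, Fin.forall_fin_succ.2 ⟨?_, fun i => ?_⟩,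
      Fin.forall_fin_succ.2 ⟨fun _ => ?_, fun i hi => ?_⟩, ?_⟩
    · exact (hSW i).trans Finset.sdiff_subset
    · by_cases huB : u ∈ B
      · refine ⟨0, huB, Fin.cases (fun _ => rfl) fun i hi => ?_⟩
        exact absurd huB (hSB (i := i) hi)
      · obtain ⟨i, hi, hiu⟩ := hSu u (Finset.mem_sdiff.2 ⟨hu, huB⟩)
        refine ⟨i.succ, hi, Fin.cases (fun h => absurd h huB) fun j hj => ?_⟩
        exact congrArg Fin.succ (hiu j hj)
    · have := Finset.card_pos.2 ⟨v, hvC⟩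
      rw [Fin.cons_zero]
      omega
    · exact hS2 i
    · exact ⟨p, Finset.mem_insert_self _ _, hBstar⟩
    · exact hSs i
    · rw [Fin.cons_zero]
      omega
    · exact hSD i fun h => hi (h ▸ Fin.succ_last r)
    · exact hSl
  · have hW'eq : W \ B = {ρ} := by
      refine (Finset.eq_of_subset_of_card_le (Finset.singleton_subset_iff.2 hρW') ?_).symm
      rw [Finset.card_singleton]
      omega
    have hparp : par p = ρ := by
      refine Finset.mem_singleton.1 (hW'eq ▸ Finset.mem_sdiff.2 ⟨hW p hpW hpρ, fun h => ?_⟩)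
      rcases Finset.mem_insert.1 h with h | h
      · exact (hadj p hpρ).ne h.symm
      · have := hCd h
        omega
    refine single p hpW (fun w hw hwp => ?_) ?_
    · by_cases hwB : w ∈ B
      · exact hBstar w hwB hwp
      · have : w ∈ W \ B := Finset.mem_sdiff.2 ⟨hw, hwB⟩
        rw [hW'eq, Finset.mem_singleton] at this
        rw [this, ← hparp]
        exact hadj p hpρ
    · have := Finset.card_sdiff_add_card_eq_card hBW
      rw [hW'eq, Finset.card_singleton] at this
      omega

/-- Let `G` be a connected finite simple graph on at least 2 vertices
and let `T` be a spanning tree of `G` with maximum degree `Δ(T)`.  Then `G` admits a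
star partition `S_1, …, S_r` of its vertex set such that `|S_i| ≤ Δ(T)` for every
`i ∈ {1, …, r−1}` and `|S_r| ≤ Δ(T) + 1`.  (In particular, every connected graph on
at least 2 vertices has a star partition.)  A star partition is a partition into sets
of size at least 2, each of which has a "center" adjacent (in `G`) to all other
vertices of the set. -/
theorem stmt_1 {V : Type*} [Fintype V] [DecidableEq V]
    (G : SimpleGraph V) (hconn : G.Connected) (hcard : 2 ≤ Fintype.card V)
    (T : SimpleGraph V) [DecidableRel T.Adj]
    (hTsub : T ≤ G) (hTtree : T.IsTree) :
    ∃ (r : ℕ) (hr : 0 < r) (S : Fin r → Finset V),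
      (∀ v : V, ∃! i, v ∈ S i) ∧
      (∀ i, 2 ≤ (S i).card) ∧
      (∀ i, ∃ c ∈ S i, ∀ w ∈ S i, w ≠ c → G.Adj c w) ∧
      (∀ i : Fin r, (i : ℕ) < r - 1 → (S i).card ≤ T.maxDegree) ∧
      (S ⟨r - 1, by omega⟩).card ≤ T.maxDegree + 1 := by
  obtain ⟨ρ⟩ := hconn.nonempty
  choose! par hadj hd using fun v (hv : v ≠ ρ) =>
    hTtree.1.exists_adj_dist_add_one_eq_s1 hv
  obtain ⟨r, S, -, hSu, hS2, hSs, hSD, hSl⟩ :=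
    T.exists_star_partition_of_parent T.degree_le_maxDegree ρ par (fun v => T.dist v ρ)
      SimpleGraph.dist_self hadj hd Finset.univ (Finset.mem_univ ρ)
      (fun _ _ _ => Finset.mem_univ _) hcard
  refine ⟨r + 1, r.succ_pos, S, fun v => hSu v (Finset.mem_univ v), hS2, fun i => ?_,
    fun i hi => hSD i ?_, hSl⟩
  · obtain ⟨c, hc, hcS⟩ := hSs i
    exact ⟨c, hc, fun w hw hwc => hTsub (hcS w hw hwc)⟩
  · rintro rfl
    simp at hi
end

section
/- For every fixed real number τ ≥ 1, define α_τ : [2, ∞) → ℝ by α_τ(d) = (2(τ+2)^{d−1} + τ(τ+1)^{d−1})^{1/d}. Then there exists d_0 ≥ 2 such that α_τ is antitone (non-increasing) on the interval [2, d_0] and monotone (non-decreasing) on the interval [d_0, ∞). -/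
open Filter Topology

/-- The `d`-th root of a weighted sum of two exponentials. -/
noncomputable def rootExpSum (p q a b d : ℝ) : ℝ :=
  (p * a ^ (d - 1) + q * b ^ (d - 1)) ^ (1 / d)

/-- The sum of exponentials, normalised by `c ^ d`. -/
noncomputable def scaledExpSum (p q a b c d : ℝ) : ℝ :=
  p / a * (a / c) ^ d + q / b * (b / c) ^ d

section

variable {p q a b : ℝ}

lemma scaledExpSum_eq_div (ha : 0 < a) (hb : 0 < b) {c : ℝ} (hc : 0 < c) (d : ℝ) :
    scaledExpSum p q a b c d = (p * a ^ (d - 1) + q * b ^ (d - 1)) / c ^ d := by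
  have hcd := Real.rpow_pos_of_pos hc d
  rw [scaledExpSum, Real.div_rpow ha.le hc.le, Real.div_rpow hb.le hc.le,
    Real.rpow_sub_one ha.ne', Real.rpow_sub_one hb.ne']
  field_simp

lemma rootExpSum_pos (hp : 0 < p) (hq : 0 < q) (ha : 0 < a) (hb : 0 < b) (d : ℝ) :
    0 < rootExpSum p q a b d := by
  unfold rootExpSum
  positivity

lemma rootExpSum_le_iff (hp : 0 < p) (hq : 0 < q) (ha : 0 < a) (hb : 0 < b)
    {c d : ℝ} (hc : 0 < c) (hd : 0 < d) :
    rootExpSum p q a b d ≤ c ↔ scaledExpSum p q a b c d ≤ 1 := by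
  rw [scaledExpSum_eq_div ha hb hc, div_le_one (Real.rpow_pos_of_pos hc d), rootExpSum, one_div,
    Real.rpow_inv_le_iff_of_pos (by positivity) hc.le hd]

lemma rootExpSum_lt_iff (hp : 0 < p) (hq : 0 < q) (ha : 0 < a) (hb : 0 < b)
    {c d : ℝ} (hc : 0 < c) (hd : 0 < d) :
    rootExpSum p q a b d < c ↔ scaledExpSum p q a b c d < 1 := by
  rw [scaledExpSum_eq_div ha hb hc, div_lt_one (Real.rpow_pos_of_pos hc d), rootExpSum, one_div,
    Real.rpow_inv_lt_iff_of_pos (by positivity) hc.le hd]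

lemma convexOn_scaledExpSum (hp : 0 < p) (hq : 0 < q) (ha : 0 < a) (hb : 0 < b)
    {c : ℝ} (hc : 0 < c) : ConvexOn ℝ Set.univ (scaledExpSum p q a b c) :=
  ((convexOn_rpow_left (div_pos ha hc)).smul (div_pos hp ha).le).add
    ((convexOn_rpow_left (div_pos hb hc)).smul (div_pos hq hb).le)

lemma quasiconvexOn_rootExpSum (hp : 0 < p) (hq : 0 < q) (ha : 0 < a) (hb : 0 < b) :
    QuasiconvexOn ℝ (Set.Ioi 0) (rootExpSum p q a b) := by
  intro c
  rcases le_or_gt c 0 with hc | hc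
  · convert convex_empty (𝕜 := ℝ) (E := ℝ)
    ext d
    simpa using fun _ => hc.trans_lt (rootExpSum_pos hp hq ha hb d)
  · convert ((convexOn_scaledExpSum hp hq ha hb hc).subset (Set.subset_univ _)
      (convex_Ioi (0 : ℝ))).convex_le 1 using 1
    ext d
    exact and_congr_right fun hd => rootExpSum_le_iff hp hq ha hb hc hd

lemma continuousOn_rootExpSum (hp : 0 < p) (hq : 0 < q) (ha : 0 < a) (hb : 0 < b) :
    ContinuousOn (rootExpSum p q a b) (Set.Ioi 0) := by
  intro d hd
  have hd' : d ≠ 0 := ne_of_gt hd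
  unfold rootExpSum
  refine ContinuousAt.continuousWithinAt (ContinuousAt.rpow ?_ ?_ (Or.inl (by positivity)))
  · exact ((continuousAt_const.rpow (by fun_prop) (Or.inl ha.ne')).const_mul p).add
      ((continuousAt_const.rpow (by fun_prop) (Or.inl hb.ne')).const_mul q)
  · fun_prop (disch := assumption)

/-- Below the larger base `a`, every level is eventually exceeded. -/
lemma eventually_lt_rootExpSum (hp : 0 < p) (hq : 0 < q) (ha : 0 < a) (hb : 0 < b)
    {c : ℝ} (hc : 0 < c) (hca : c < a) : ∀ᶠ d in atTop, c < rootExpSum p q a b d := by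
  have hlim : Tendsto (fun d : ℝ => p / a * (a / c) ^ d) atTop atTop :=
    (tendsto_rpow_atTop_of_base_gt_one _ ((one_lt_div hc).2 hca)).const_mul_atTop
      (div_pos hp ha)
  filter_upwards [hlim.eventually_gt_atTop 1, eventually_gt_atTop 0] with d h1 hd
  rw [← not_le, rootExpSum_le_iff hp hq ha hb hc hd, not_le, scaledExpSum]
  have : 0 < q / b * (b / c) ^ d := by positivity
  linarith

/-- If `p < a` and `b < a`, the root eventually drops below its limit `a`. -/
lemma eventually_rootExpSum_lt (hp : 0 < p) (hq : 0 < q) (hb : 0 < b) (hba : b < a)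
    (hpa : p < a) : ∀ᶠ d in atTop, rootExpSum p q a b d < a := by
  have ha : 0 < a := hb.trans hba
  have hlim : Tendsto (scaledExpSum p q a b a) atTop (𝓝 (p / a * 1 + q / b * 0)) := by
    unfold scaledExpSum
    refine Tendsto.add (by simp [div_self ha.ne']) (Tendsto.const_mul _ ?_)
    exact tendsto_rpow_atTop_of_base_lt_one _ (by linarith [div_pos hb ha]) ((div_lt_one ha).2 hba)
  have hlt : p / a * 1 + q / b * 0 < 1 := by simpa using (div_lt_one ha).2 hpa
  filter_upwards [hlim.eventually_lt_const hlt, eventually_gt_atTop 0] with d h hd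
  exact (rootExpSum_lt_iff hp hq ha hb ha hd).2 h

lemma exists_isMinOn_rootExpSum (hp : 0 < p) (hq : 0 < q) (hb : 0 < b) (hba : b < a)
    (hpa : p < a) {s : ℝ} (hs : 0 < s) :
    ∃ d₀ ∈ Set.Ici s, IsMinOn (rootExpSum p q a b) (Set.Ici s) d₀ := by
  have ha : 0 < a := hb.trans hba
  obtain ⟨d₁, hd₁, hsd₁⟩ :=
    ((eventually_rootExpSum_lt hp hq hb hba hpa).and (eventually_ge_atTop s)).exists
  obtain ⟨M, hM⟩ := eventually_atTop.1
    (eventually_lt_rootExpSum hp hq ha hb (rootExpSum_pos hp hq ha hb d₁) hd₁)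
  have hd₁M : d₁ ∈ Set.Icc s (max M d₁) := ⟨hsd₁, le_max_right _ _⟩
  obtain ⟨d₀, hd₀, hmin⟩ := isCompact_Icc.exists_isMinOn ⟨d₁, hd₁M⟩
    ((continuousOn_rootExpSum hp hq ha hb).mono fun x hx => hs.trans_le hx.1)
  refine ⟨d₀, hd₀.1, fun d hd => ?_⟩
  rcases le_total d (max M d₁) with h | h
  · exact hmin ⟨hd, h⟩
  · exact (hmin hd₁M).trans (hM d ((le_max_left _ _).trans h)).le

end

/-- A quasiconvex function is antitone to the left of a minimiser. -/
lemma QuasiconvexOn.antitoneOn_of_isMinOn {f : ℝ → ℝ} {s : Set ℝ} (hf : QuasiconvexOn ℝ s f)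
    {x₀ : ℝ} (hx₀ : x₀ ∈ s) (hmin : IsMinOn f s x₀) : AntitoneOn f (s ∩ Set.Iic x₀) := by
  intro x hx y hy hxy
  exact ((hf (f x)).ordConnected.out ⟨hx.1, le_rfl⟩ ⟨hx₀, hmin hx.1⟩ ⟨hxy, hy.2⟩).2

/-- A quasiconvex function is monotone to the right of a minimiser. -/
lemma QuasiconvexOn.monotoneOn_of_isMinOn {f : ℝ → ℝ} {s : Set ℝ} (hf : QuasiconvexOn ℝ s f)
    {x₀ : ℝ} (hx₀ : x₀ ∈ s) (hmin : IsMinOn f s x₀) : MonotoneOn f (s ∩ Set.Ici x₀) := by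
  intro x hx y hy hxy
  exact ((hf (f y)).ordConnected.out ⟨hx₀, hmin hy.1⟩ ⟨hy.1, le_rfl⟩ ⟨hx.2, hxy⟩).2

/-- For every fixed real `τ ≥ 1`, define
`α_τ(d) = (2(τ+2)^{d−1} + τ(τ+1)^{d−1})^{1/d}` (real powers) for `d ≥ 2`.
Then there exists `d₀ ≥ 2` such that `α_τ` is antitone (non-increasing) on
`[2, d₀]` and monotone (non-decreasing) on `[d₀, ∞)`. -/
theorem stmt_6 (τ : ℝ) (hτ : 1 ≤ τ) :
    ∃ d₀ : ℝ, 2 ≤ d₀ ∧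
      AntitoneOn (fun d : ℝ =>
        (2 * (τ + 2) ^ (d - 1) + τ * (τ + 1) ^ (d - 1)) ^ (1 / d)) (Set.Icc 2 d₀) ∧
      MonotoneOn (fun d : ℝ =>
        (2 * (τ + 2) ^ (d - 1) + τ * (τ + 1) ^ (d - 1)) ^ (1 / d)) (Set.Ici d₀) := by
  have hτ0 : 0 < τ := by linarith
  obtain ⟨d₀, hd₀, hmin⟩ := exists_isMinOn_rootExpSum (p := 2) (q := τ) (a := τ + 2) (b := τ + 1)
    two_pos hτ0 (by linarith) (by linarith) (by linarith) two_pos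
  have hqc : QuasiconvexOn ℝ (Set.Ici 2) (rootExpSum 2 τ (τ + 2) (τ + 1)) := by
    intro c
    have hset : {d | d ∈ Set.Ici (2 : ℝ) ∧ rootExpSum 2 τ (τ + 2) (τ + 1) d ≤ c} =
        Set.Ici 2 ∩ {d | d ∈ Set.Ioi (0 : ℝ) ∧ rootExpSum 2 τ (τ + 2) (τ + 1) d ≤ c} :=
      Set.ext fun d => ⟨fun h => ⟨h.1, Set.mem_Ioi.2 (two_pos.trans_le h.1), h.2⟩, fun h => ⟨h.1, h.2.2⟩⟩
    rw [hset]
    exact (convex_Ici 2).inter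
      (quasiconvexOn_rootExpSum two_pos hτ0 (by linarith) (by linarith) c)
  exact ⟨d₀, hd₀, hqc.antitoneOn_of_isMinOn hd₀ hmin,
    (hqc.monotoneOn_of_isMinOn hd₀ hmin).mono fun d hd => ⟨Set.mem_Ici.2 (le_trans hd₀ hd), hd⟩⟩
end

section
/- Let τ ≥ 1 be a real number and D ≥ 1 an integer. Let s_1, s_2, …, s_r be integers with 2 ≤ s_i ≤ D+1 for every i, and let n = s_1 + s_2 + ⋯ + s_r. Then ∏_{i=1}^r (2(τ+2)^{s_i−1} + τ(τ+1)^{s_i−1}) ≤ M^n, where M = max{ (τ² + 3τ + 4)^{1/2}, (2(τ+2)^{D} + τ(τ+1)^{D})^{1/(D+1)} }. -/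
/-- A nonnegative combination of two geometric sequences is bounded, on an interval of exponents,
by any common bound for its values at the endpoints. -/
theorem add_mul_pow_le_of_endpoints {A B a b c : ℝ} (hA : 0 ≤ A) (hB : 0 ≤ B) (ha : 0 < a)
    (hb : 0 < b) {j k l : ℕ} (hjk : j ≤ k) (hkl : k ≤ l) (hj : A * a ^ j + B * b ^ j ≤ c)
    (hl : A * a ^ l + B * b ^ l ≤ c) : A * a ^ k + B * b ^ k ≤ c := by
  have hconv : ConvexOn ℝ Set.univ fun x : ℝ => A * a ^ x + B * b ^ x :=
    ((convexOn_rpow_left ha).smul hA).add ((convexOn_rpow_left hb).smul hB)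
  have h := hconv.le_max_of_mem_Icc (Set.mem_univ (j : ℝ)) (Set.mem_univ (l : ℝ))
    (z := (k : ℝ)) ⟨by exact_mod_cast hjk, by exact_mod_cast hkl⟩
  simp only [Real.rpow_natCast] at h
  exact h.trans (max_le hj hl)

/-- If `A a ^ k + B b ^ k ≤ M ^ (k + 1)` holds at both ends of an interval of exponents, then it
holds throughout. -/
theorem add_mul_pow_le_pow_succ_of_endpoints {A B a b M : ℝ} (hA : 0 ≤ A) (hB : 0 ≤ B)
    (ha : 0 < a) (hb : 0 < b) (hM : 0 < M) {j k l : ℕ} (hjk : j ≤ k) (hkl : k ≤ l)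
    (hj : A * a ^ j + B * b ^ j ≤ M ^ (j + 1)) (hl : A * a ^ l + B * b ^ l ≤ M ^ (l + 1)) :
    A * a ^ k + B * b ^ k ≤ M ^ (k + 1) := by
  have key (m : ℕ) : A * a ^ m + B * b ^ m ≤ M ^ (m + 1) ↔
      A * (a / M) ^ m + B * (b / M) ^ m ≤ M := by
    rw [div_pow, div_pow, mul_div_assoc', mul_div_assoc', ← add_div, div_le_iff₀ (by positivity),
      pow_succ']
  rw [key] at hj hl ⊢
  exact add_mul_pow_le_of_endpoints hA hB (div_pos ha hM) (div_pos hb hM) hjk hkl hj hl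

/-- Let `τ ≥ 1` be real and `D ≥ 1` an integer.  Let `s_1, …, s_r` be
integers with `2 ≤ s_i ≤ D+1` for every `i`, and `n = s_1 + ⋯ + s_r`.  Then
`∏_{i=1}^r (2(τ+2)^{s_i−1} + τ(τ+1)^{s_i−1}) ≤ M^n`, where
`M = max{ (τ² + 3τ + 4)^{1/2}, (2(τ+2)^D + τ(τ+1)^D)^{1/(D+1)} }` (real roots). -/
theorem stmt_7 (τ : ℝ) (hτ : 1 ≤ τ) (D : ℕ) (hD : 1 ≤ D)
    (r : ℕ) (s : Fin r → ℕ) (hs : ∀ i, 2 ≤ s i ∧ s i ≤ D + 1)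
    (n : ℕ) (hn : n = ∑ i, s i) :
    ∏ i, (2 * (τ + 2) ^ (s i - 1) + τ * (τ + 1) ^ (s i - 1)) ≤
      (max ((τ ^ 2 + 3 * τ + 4) ^ ((1 : ℝ) / 2))
        ((2 * (τ + 2) ^ D + τ * (τ + 1) ^ D) ^ ((1 : ℝ) / (D + 1)))) ^ n := by
  set M := max ((τ ^ 2 + 3 * τ + 4) ^ ((1 : ℝ) / 2))
    ((2 * (τ + 2) ^ D + τ * (τ + 1) ^ D) ^ ((1 : ℝ) / (D + 1)))
  have hτ0 : 0 < τ := by linarith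
  have hMpos : 0 < M := lt_max_of_lt_left (by positivity)
  have hone : 2 * (τ + 2) ^ 1 + τ * (τ + 1) ^ 1 ≤ M ^ (1 + 1) := by
    calc 2 * (τ + 2) ^ 1 + τ * (τ + 1) ^ 1
        = ((τ ^ 2 + 3 * τ + 4) ^ ((1 : ℝ) / 2)) ^ 2 := by
          rw [← Real.sqrt_eq_rpow, Real.sq_sqrt (by positivity)]
          ring
      _ ≤ M ^ 2 := by
          gcongr
          exact le_max_left _ _
  have htop : 2 * (τ + 2) ^ D + τ * (τ + 1) ^ D ≤ M ^ (D + 1) := by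
    calc 2 * (τ + 2) ^ D + τ * (τ + 1) ^ D
        = ((2 * (τ + 2) ^ D + τ * (τ + 1) ^ D) ^ ((1 : ℝ) / (D + 1))) ^ (D + 1) := by
          have h := Real.rpow_inv_natCast_pow
            (by positivity : 0 ≤ 2 * (τ + 2) ^ D + τ * (τ + 1) ^ D) D.succ_ne_zero
          rw [Nat.cast_succ, ← one_div] at h
          exact h.symm
      _ ≤ M ^ (D + 1) := by
          gcongr
          exact le_max_right _ _
  rw [hn, ← Finset.prod_pow_eq_pow_sum]
  refine Finset.prod_le_prod (fun i _ => by positivity) fun i _ => ?_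
  obtain ⟨h2, hle⟩ := hs i
  have h := add_mul_pow_le_pow_succ_of_endpoints zero_le_two hτ0.le (by positivity)
    (by positivity) hMpos (show 1 ≤ s i - 1 by omega) (show s i - 1 ≤ D by omega) hone htop
  rwa [Nat.sub_add_cancel (by omega)] at h
end
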